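/- arXiv:1301.0529 — 4 statements merged into one kernel-verified Lean document; each statement's English description precedes it below -/
import Mathlib

section
/- Let n be a positive integer and let E ⊂ Q be a measurable set of positive measure such that Δ_t(E) < μ(E)/(2n) for every t ∈ [0,1]. Then the set Ω₁ = {ω ∈ Ω : m(E_ω) > 1 − 1/n} satisfies P(Ω₁) > (1/2)μ(E). -/
open MeasureTheory
open scoped ENNReal

/-- The overlap of a translate of `A` with the complement of `A`, averaged over all translations. -/
theorem lintegral_measure_translate_diff {G : Type*} [AddCommGroup G] [MeasurableSpace G]
    [MeasurableAdd₂ G] [MeasurableNeg G] (ν : Measure G) [SFinite ν] [ν.IsAddLeftInvariant]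
    [ν.IsNegInvariant] {A : Set G} (hA : MeasurableSet A) :
    ∫⁻ x, ν ({θ | θ - x ∈ A} \ A) ∂ν = ν A * ν Aᶜ := by
  have hsub : ∀ x, MeasurableSet {θ : G | θ - x ∈ A} := fun x =>
    (measurable_id.sub_const x) hA
  have h1 : ∀ x, ν ({θ | θ - x ∈ A} \ A) =
      ∫⁻ θ, Aᶜ.indicator 1 θ * A.indicator (1 : G → ℝ≥0∞) (θ - x) ∂ν := by
    intro x
    rw [← lintegral_indicator_one ((hsub x).diff hA)]
    refine lintegral_congr fun θ => ?_
    by_cases h : θ ∈ A <;> by_cases h' : θ - x ∈ A <;> simp [Set.indicator, h, h']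
  have hm : Measurable (A.indicator (1 : G → ℝ≥0∞)) := measurable_one.indicator hA
  have hm' : Measurable (Aᶜ.indicator (1 : G → ℝ≥0∞)) := measurable_one.indicator hA.compl
  simp_rw [h1]
  rw [lintegral_lintegral_swap]
  · have h2 : ∀ θ, ∫⁻ x, Aᶜ.indicator 1 θ * A.indicator (1 : G → ℝ≥0∞) (θ - x) ∂ν
        = Aᶜ.indicator 1 θ * ν A := by
      intro θ
      have hmθ : Measurable fun x => A.indicator (1 : G → ℝ≥0∞) (θ - x) :=
        hm.comp (measurable_id.const_sub θ)
      rw [lintegral_const_mul _ hmθ,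
        lintegral_sub_left_eq_self (A.indicator (1 : G → ℝ≥0∞)) θ, lintegral_indicator_one hA]
    simp_rw [h2]
    rw [lintegral_mul_const _ hm', lintegral_indicator_one hA.compl, mul_comm]
  · exact ((hm'.comp measurable_snd).mul
      (hm.comp (measurable_snd.sub measurable_fst))).aemeasurable

/-- The measure of `(E + x) \ E`, averaged over all fibrewise translations `x`. -/
theorem lintegral_prod_translate_diff {Ω G : Type*} [MeasurableSpace Ω] (P : Measure Ω)
    [SFinite P] [AddCommGroup G] [MeasurableSpace G]
    [MeasurableAdd₂ G] [MeasurableNeg G] (ν : Measure G) [SFinite ν] [ν.IsAddLeftInvariant]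
    [ν.IsNegInvariant] {E : Set (Ω × G)} (hE : MeasurableSet E) :
    ∫⁻ x, (P.prod ν) ({q : Ω × G | (q.1, q.2 - x) ∈ E} \ E) ∂ν =
      ∫⁻ ω, ν (Prod.mk ω ⁻¹' E) * ν (Prod.mk ω ⁻¹' E)ᶜ ∂P := by
  have hD : MeasurableSet {p : (G × Ω) × G | (p.1.2, p.2 - p.1.1) ∈ E ∧ (p.1.2, p.2) ∉ E} := by
    refine MeasurableSet.inter ?_ (MeasurableSet.compl ?_)
    · exact (measurable_fst.snd.prodMk (measurable_snd.sub measurable_fst.fst)) hE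
    · exact (measurable_fst.snd.prodMk measurable_snd) hE
  have h1 : ∀ x, (P.prod ν) ({q : Ω × G | (q.1, q.2 - x) ∈ E} \ E) =
      ∫⁻ ω, ν ({θ | θ - x ∈ Prod.mk ω ⁻¹' E} \ Prod.mk ω ⁻¹' E) ∂P := by
    intro x
    rw [Measure.prod_apply]
    · rfl
    · exact ((measurable_fst.prodMk (measurable_snd.sub_const x)) hE).diff hE
  simp_rw [h1]
  rw [lintegral_lintegral_swap]
  · exact lintegral_congr fun ω => lintegral_measure_translate_diff ν (measurable_prodMk_left hE)
  · exact (measurable_measure_prodMk_left hD).aemeasurable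

/-- **Sets failing condition `(C_E)` have many long sections.**
If `E ⊆ Q = Ω × ℝ/ℤ` has positive measure and `Δ_t(E) = μ((E+t)\E) < μ(E)/(2n)` for every
`t ∈ [0,1]`, then `Ω₁ = {ω : m(E_ω) > 1 − 1/n}` satisfies `P(Ω₁) > μ(E)/2`. -/
theorem many_long_sections :
    ∀ (Ω : Type) [MeasurableSpace Ω] (P : Measure Ω) [IsProbabilityMeasure P]
      (n : ℕ), 0 < n →
      ∀ E : Set (Ω × AddCircle (1 : ℝ)), MeasurableSet E →
        0 < (P.prod volume) E →
        (∀ t : ℝ, 0 ≤ t → t ≤ 1 →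
          (P.prod volume)
              ({q : Ω × AddCircle (1 : ℝ) | (q.1, q.2 - (t : AddCircle (1 : ℝ))) ∈ E} \ E)
            < (P.prod volume) E / (2 * n)) →
        (P.prod volume) E / 2 <
          P {ω : Ω |
            1 - 1 / (n : ℝ≥0∞) < volume {θ : AddCircle (1 : ℝ) | (ω, θ) ∈ E}} := by
  intro Ω _ P _ n hn E hE hpos hΔ
  have : IsProbabilityMeasure (volume : Measure (AddCircle (1 : ℝ))) :=
    ⟨by rw [AddCircle.measure_univ, ENNReal.ofReal_one]⟩
  set μ := P.prod (volume : Measure (AddCircle (1 : ℝ)))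
  set f : Ω → ℝ≥0∞ := fun ω => volume (Prod.mk ω ⁻¹' E)
  have hfm : Measurable f := measurable_measure_prodMk_left hE
  have hf1 : ∀ ω, f ω ≤ 1 := fun ω => prob_le_one
  have hc : ∀ ω, volume (Prod.mk ω ⁻¹' E)ᶜ = 1 - f ω := fun ω =>
    prob_compl_eq_one_sub (measurable_prodMk_left hE)
  have hn0 : (n : ℝ≥0∞) ≠ 0 := by exact_mod_cast hn.ne'
  have hnt : (n : ℝ≥0∞) ≠ ∞ := ENNReal.natCast_ne_top n
  have hΔ' : ∀ x : AddCircle (1 : ℝ),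
      μ ({q : Ω × AddCircle (1 : ℝ) | (q.1, q.2 - x) ∈ E} \ E) < μ E / (2 * n) := by
    intro x
    obtain ⟨t, ht, rfl⟩ : x ∈ (fun t : ℝ => (t : AddCircle (1 : ℝ))) '' Set.Ico 0 (0 + 1) := by
      rw [AddCircle.coe_image_Ico_eq]; trivial
    exact hΔ t ht.1 (by linarith [ht.2])
  have havg : ∫⁻ ω, f ω * (1 - f ω) ∂P < μ E / (2 * n) := by
    have h := lintegral_prod_translate_diff P (volume : Measure (AddCircle (1 : ℝ))) hE
    simp_rw [hc] at h
    have hlt := lintegral_strict_mono (μ := (volume : Measure (AddCircle (1 : ℝ))))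
      (f := fun x => μ ({q : Ω × AddCircle (1 : ℝ) | (q.1, q.2 - x) ∈ E} \ E))
      (g := fun _ => μ E / (2 * n)) (NeZero.ne _) aemeasurable_const
      (h.trans_ne ?_) (Filter.Eventually.of_forall hΔ')
    · rw [h] at hlt
      simpa using hlt
    · refine ((lintegral_mono fun ω => mul_le_mul' (hf1 ω) tsub_le_self).trans_lt
        (b := ∫⁻ _, 1 * 1 ∂P) ?_).ne
      simp
  set S : Set Ω := {ω | 1 - 1 / (n : ℝ≥0∞) < f ω}
  have hSm : MeasurableSet S := measurableSet_lt measurable_const hfm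
  have hμE : μ E = ∫⁻ ω, f ω ∂P := Measure.prod_apply hE
  have hshort : ∫⁻ ω in Sᶜ, f ω ∂P < μ E / 2 := by
    calc ∫⁻ ω in Sᶜ, f ω ∂P ≤ ∫⁻ ω in Sᶜ, n * (f ω * (1 - f ω)) ∂P := by
          refine setLIntegral_mono' hSm.compl fun ω hω => ?_
          have h : f ω ≤ 1 - 1 / (n : ℝ≥0∞) := not_lt.mp hω
          have hinv : 1 / (n : ℝ≥0∞) ≤ 1 := by
            rw [one_div, ENNReal.inv_le_one]
            exact_mod_cast hn
          have h' : 1 / (n : ℝ≥0∞) ≤ 1 - f ω := by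
            have := tsub_le_tsub_left h 1
            rwa [ENNReal.sub_sub_cancel ENNReal.one_ne_top hinv] at this
          calc f ω = n * (f ω * (1 / n)) := by
                rw [mul_left_comm, one_div, ENNReal.mul_inv_cancel hn0 hnt, mul_one]
            _ ≤ _ := by gcongr
      _ ≤ ∫⁻ ω, n * (f ω * (1 - f ω)) ∂P := setLIntegral_le_lintegral _ _
      _ = n * ∫⁻ ω, f ω * (1 - f ω) ∂P :=
          lintegral_const_mul _ (hfm.mul (measurable_const.sub hfm))
      _ < n * (μ E / (2 * n)) := (ENNReal.mul_lt_mul_iff_right hn0 hnt).mpr havg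
      _ = μ E / 2 := by
          rw [div_eq_mul_inv, ENNReal.mul_inv (Or.inl two_ne_zero) (Or.inr hn0), div_eq_mul_inv,
            ← mul_assoc, mul_left_comm, ← mul_assoc, mul_comm (n : ℝ≥0∞), mul_assoc, mul_assoc,
            ENNReal.mul_inv_cancel hn0 hnt, mul_one, mul_comm]
  have hlong : ∫⁻ ω in S, f ω ∂P ≤ P S := by
    calc ∫⁻ ω in S, f ω ∂P ≤ ∫⁻ _ in S, 1 ∂P := lintegral_mono hf1
      _ = P S := setLIntegral_one S
  by_contra! hcon
  have hcon' : P S ≤ μ E / 2 := hcon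
  have : μ E < μ E := by
    calc μ E = ∫⁻ ω in S, f ω ∂P + ∫⁻ ω in Sᶜ, f ω ∂P := by
          rw [lintegral_add_compl _ hSm, hμE]
      _ < μ E / 2 + μ E / 2 := by
          refine ENNReal.add_lt_add_of_le_of_lt ?_ (hlong.trans hcon') hshort
          exact ((hlong.trans prob_le_one).trans_lt ENNReal.one_lt_top).ne
      _ = μ E := ENNReal.add_halves _
  exact this.false
end

section
/- Let τ > 0 and let G ⊂ (0,∞) be a measurable set with m(G) > 0 (m denotes Lebesgue measure on ℝ). Define V_G = { t ∈ (τ/2, τ) : there exists a positive integer k with k/t ∈ G }. Then m(V_G) < τ²·m(G). -/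
open MeasureTheory

/-- The inversion `s ↦ c / s` maps a measurable set of positive reals to a set of measure
`∫ c / s²`. -/
lemma volume_image_const_div {c : ℝ} (hc : 0 < c) {S : Set ℝ} (hS : MeasurableSet S)
    (hpos : S ⊆ Set.Ioi 0) :
    volume ((fun s : ℝ => c / s) '' S) = ∫⁻ s in S, ENNReal.ofReal (c / s ^ 2) := by
  have hderiv : ∀ s ∈ S, HasDerivWithinAt (fun s : ℝ => c / s) (-(c / s ^ 2)) S s := by
    intro s hs
    have hs0 : s ≠ 0 := (hpos hs).ne'
    have h := ((hasDerivAt_inv hs0).const_mul c).hasDerivWithinAt (s := S)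
    refine (h.congr_deriv ?_)
    field_simp
  have hinj : Set.InjOn (fun s : ℝ => c / s) S := by
    intro a ha b hb hab
    have ha0 : a ≠ 0 := (hpos ha).ne'
    have hb0 : b ≠ 0 := (hpos hb).ne'
    have hab : c / a = c / b := hab
    rw [div_eq_div_iff ha0 hb0] at hab
    exact (mul_left_cancel₀ hc.ne' hab).symm
  have h := lintegral_image_eq_lintegral_abs_deriv_mul hS hderiv hinj (fun _ => 1)
  simp only [mul_one, lintegral_const, Measure.restrict_apply_univ, one_mul, abs_neg] at h
  rw [h]
  refine lintegral_congr fun s => ?_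
  rw [abs_of_nonneg (by positivity)]

/-- The positive integers below `x > 0` have sum less than `x²`. -/
lemma sum_range_ceil_sub_one_lt_sq {x : ℝ} (hx : 0 < x) :
    ∑ k ∈ Finset.range (⌈x⌉₊ - 1), ((k : ℝ) + 1) < x ^ 2 := by
  set N := ⌈x⌉₊ - 1 with hN
  have hNx : (N : ℝ) < x := by
    have hceil : 0 < ⌈x⌉₊ := Nat.ceil_pos.2 hx
    exact Nat.lt_ceil.1 (by omega)
  have hle : ∑ k ∈ Finset.range N, ((k : ℝ) + 1) ≤ N * N := by
    calc ∑ k ∈ Finset.range N, ((k : ℝ) + 1) ≤ ∑ _k ∈ Finset.range N, (N : ℝ) := by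
          refine Finset.sum_le_sum fun k hk => ?_
          exact_mod_cast Finset.mem_range.1 hk
      _ = N * N := by simp
  have h0 : (0 : ℝ) ≤ N := N.cast_nonneg
  nlinarith

/-- The positive integers `k < s τ`, each weighted by `1 / s²`, have total weight less than `τ²`. -/
lemma tsum_indicator_div_sq_lt {τ s : ℝ} (hτ : 0 < τ) (hs : 0 < s) :
    ∑' k : ℕ, (Set.Ioi (((k : ℝ) + 1) / τ)).indicator
      (fun s : ℝ => ENNReal.ofReal (((k : ℝ) + 1) / s ^ 2)) s < ENNReal.ofReal (τ ^ 2) := by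
  have hmem : ∀ k : ℕ, s ∈ Set.Ioi (((k : ℝ) + 1) / τ) ↔ k ∈ Finset.range (⌈s * τ⌉₊ - 1) := by
    intro k
    rw [Set.mem_Ioi, div_lt_iff₀ hτ, Finset.mem_range, Nat.lt_sub_iff_add_lt, Nat.lt_ceil]
    push_cast
    rfl
  rw [tsum_eq_sum (s := Finset.range (⌈s * τ⌉₊ - 1))
    fun k hk => Set.indicator_of_notMem (fun h => hk ((hmem k).1 h)) _]
  rw [Finset.sum_congr rfl fun k hk => Set.indicator_of_mem ((hmem k).2 hk) _,
    ← ENNReal.ofReal_sum_of_nonneg fun k _ => by positivity, ← Finset.sum_div]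
  refine (ENNReal.ofReal_lt_ofReal_iff (by positivity)).2 ?_
  rw [div_lt_iff₀ (by positivity), ← mul_pow, mul_comm τ s]
  exact sum_range_ceil_sub_one_lt_sq (by positivity)

/-- **A lemma on arithmetic progressions.**
For a measurable set `G ⊆ (0,∞)` of positive Lebesgue measure and `τ > 0`, the set
`V_G = {t ∈ (τ/2,τ) : ∃ k ∈ ℕ, k ≥ 1, k/t ∈ G}` satisfies `m(V_G) < τ² m(G)`. -/
theorem arithmetic_progressions_lemma :
    ∀ τ : ℝ, 0 < τ →
      ∀ G : Set ℝ, G ⊆ Set.Ioi (0 : ℝ) → MeasurableSet G → 0 < volume G →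
        volume {t ∈ Set.Ioo (τ / 2) τ | ∃ k : ℕ, 0 < k ∧ (k : ℝ) / t ∈ G} <
          ENNReal.ofReal (τ ^ 2) * volume G := by
  intro τ hτ G hG hGm hG0
  have hτ2 : 0 < ENNReal.ofReal (τ ^ 2) := ENNReal.ofReal_pos.2 (by positivity)
  by_cases hfin : volume G = ⊤
  · rw [hfin, ENNReal.mul_top hτ2.ne']
    exact (measure_mono (Set.sep_subset _ _)).trans_lt measure_Ioo_lt_top
  set S : ℕ → Set ℝ := fun k => Set.Ioi (((k : ℝ) + 1) / τ)
  set w : ℕ → ℝ → ENNReal := fun k s => ENNReal.ofReal (((k : ℝ) + 1) / s ^ 2)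
  have hcover : {t ∈ Set.Ioo (τ / 2) τ | ∃ k : ℕ, 0 < k ∧ (k : ℝ) / t ∈ G} ⊆
      ⋃ k : ℕ, (fun s : ℝ => ((k : ℝ) + 1) / s) '' (S k ∩ G) := by
    rintro t ⟨⟨ht, htτ⟩, k, hk, hkG⟩
    obtain ⟨j, rfl⟩ := Nat.exists_eq_succ_of_ne_zero hk.ne'
    have ht0 : 0 < t := by linarith
    push_cast at hkG
    refine Set.mem_iUnion.2 ⟨j, ((j : ℝ) + 1) / t, ⟨?_, hkG⟩, ?_⟩
    · exact div_lt_div_of_pos_left (by positivity) ht0 htτ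
    · exact div_div_cancel₀ (by positivity)
  have hlt : ∀ s ∈ G, ∑' k, (S k).indicator (w k) s < ENNReal.ofReal (τ ^ 2) :=
    fun s hs => tsum_indicator_div_sq_lt hτ (hG hs)
  have hw : ∀ k, Measurable ((S k).indicator (w k)) := fun k =>
    Measurable.indicator (by fun_prop) measurableSet_Ioi
  have hfinite : ∫⁻ s in G, ∑' k, (S k).indicator (w k) s ≠ ⊤ := by
    refine ne_top_of_le_ne_top ?_ (setLIntegral_mono measurable_const fun s hs => (hlt s hs).le)
    rw [setLIntegral_const]
    exact ENNReal.mul_ne_top ENNReal.ofReal_ne_top hfin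
  calc volume {t ∈ Set.Ioo (τ / 2) τ | ∃ k : ℕ, 0 < k ∧ (k : ℝ) / t ∈ G}
      ≤ ∑' k : ℕ, volume ((fun s : ℝ => ((k : ℝ) + 1) / s) '' (S k ∩ G)) :=
        (measure_mono hcover).trans (measure_iUnion_le _)
    _ = ∑' k : ℕ, ∫⁻ s in G, (S k).indicator (w k) s := by
        refine tsum_congr fun k => ?_
        rw [volume_image_const_div (by positivity) (measurableSet_Ioi.inter hGm)
          (Set.inter_subset_right.trans hG), setLIntegral_indicator measurableSet_Ioi]
    _ = ∫⁻ s in G, ∑' k, (S k).indicator (w k) s :=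
        (lintegral_tsum fun k => (hw k).aemeasurable).symm
    _ < ∫⁻ _s in G, ENNReal.ofReal (τ ^ 2) :=
        setLIntegral_strict_mono hGm hG0.ne' measurable_const hfinite
          (Filter.Eventually.of_forall hlt)
    _ = ENNReal.ofReal (τ ^ 2) * volume G := setLIntegral_const _ _
end

section
/- There is a constant A ≥ 1 with the following property. For every integer n ≥ 1, every Δ ∈ (0,1), and every polynomial q(z) = ∑_{k=0}^n a_k z^k with complex coefficients satisfying ∑_{k=0}^n |a_k|² = 1, the set U = { s ∈ T : |q(e(s))| < (Δ/A)^n } is a union of at most n open arcs of T, each of length at most Δ. -/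
open MeasureTheory Complex

open Polynomial in
/-- The `L²`-norm of the coefficients of a polynomial is at most its sup norm on the unit circle. -/
lemma sum_sq_norm_coeff_le_of_norm_eval_le (q : ℂ[X]) (M : ℝ)
    (hM : ∀ z : ℂ, ‖z‖ = 1 → ‖q.eval z‖ ≤ M) : ∑ i ∈ q.support, ‖q.coeff i‖ ^ 2 ≤ M ^ 2 := by
  rw [q.sum_sq_norm_coeff_eq_circleAverage]
  refine Real.circleAverage_mono_on_of_le_circle ?_ fun z hz => ?_
  · exact ContinuousOn.circleIntegrable zero_le_one (by fun_prop)
  · exact pow_le_pow_left₀ (norm_nonneg _) (hM z (by simpa using hz)) 2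

/-- The character `x ↦ e^{2πix}` of the real line. -/
noncomputable def unitExp (x : ℝ) : ℂ := exp (2 * Real.pi * I * x)

lemma norm_unitExp (x : ℝ) : ‖unitExp x‖ = 1 := by
  have h : (2 * Real.pi * I * x : ℂ) = ((2 * Real.pi * x : ℝ) : ℂ) * I := by push_cast; ring
  rw [unitExp, h, norm_exp_ofReal_mul_I]

lemma unitExp_ne_zero (x : ℝ) : unitExp x ≠ 0 := exp_ne_zero _

lemma unitExp_add_int (x : ℝ) (m : ℤ) : unitExp (x + m) = unitExp x := by
  refine exp_eq_exp_iff_exists_int.2 ⟨m, ?_⟩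
  push_cast
  ring

lemma unitExp_injOn (a : ℝ) : Set.InjOn unitExp (Set.Ioo a (a + 1)) := by
  intro x hx y hy hxy
  obtain ⟨m, hm⟩ := exp_eq_exp_iff_exists_int.1 hxy
  have h1 : (2 * Real.pi * I : ℂ) ≠ 0 := two_pi_I_ne_zero
  have h2 : (x : ℂ) = y + m := mul_left_cancel₀ h1 (by rw [hm]; ring)
  have h3 : x = y + m := by exact_mod_cast h2
  have h4 : (m : ℝ) < 1 := by linarith [hx.2, hy.1]
  have h5 : (-1 : ℝ) < m := by linarith [hx.1, hy.2]
  have h6 : m < 1 := by exact_mod_cast h4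
  have h7 : -1 < m := by exact_mod_cast h5
  obtain rfl : m = 0 := by omega
  simpa using h3

@[fun_prop]
lemma continuous_unitExp : Continuous unitExp := by
  unfold unitExp
  fun_prop

lemma four_mul_abs_sub_le_norm_unitExp_sub {x y : ℝ} (h : |x - y| ≤ 1 / 2) :
    4 * |x - y| ≤ ‖unitExp x - unitExp y‖ := by
  have h1 : unitExp x - unitExp y =
      unitExp y * (exp (I * (2 * Real.pi * (x - y) : ℝ)) - 1) := by
    rw [mul_sub, mul_one, unitExp, unitExp, ← exp_add]
    congr 2
    push_cast
    ring
  rw [h1, norm_mul, norm_unitExp, one_mul, norm_exp_I_mul_ofReal_sub_one, norm_mul,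
    Real.norm_eq_abs, Real.norm_eq_abs, abs_two]
  have h2 : |Real.pi * (x - y)| ≤ Real.pi / 2 := by
    rw [abs_mul, abs_of_pos Real.pi_pos]
    nlinarith [Real.pi_pos]
  have h3 := Real.mul_abs_le_abs_sin h2
  rw [abs_mul, abs_of_pos Real.pi_pos, ← mul_assoc, div_mul_cancel₀ _ Real.pi_ne_zero] at h3
  have h4 : 2 * Real.pi * (x - y) / 2 = Real.pi * (x - y) := by ring
  rw [h4]
  linarith

lemma prod_erase_range_abs_sub {n i : ℕ} (hi : i ≤ n) :
    ∏ j ∈ (Finset.range (n + 1)).erase i, |(i : ℝ) - j| = i.factorial * (n - i).factorial := by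
  obtain ⟨m, rfl⟩ := Nat.exists_eq_add_of_le hi
  have hs : (Finset.range (i + m + 1)).erase i =
      Finset.range i ∪ (Finset.range m).map ⟨fun k => i + 1 + k, add_right_injective _⟩ := by
    ext j
    simp only [Finset.mem_erase, Finset.mem_range, Finset.mem_union, Finset.mem_map,
      Function.Embedding.coeFn_mk]
    constructor
    · intro h
      rcases lt_or_gt_of_ne h.1 with h' | h'
      · exact Or.inl h'
      · exact Or.inr ⟨j - (i + 1), by omega, by omega⟩
    · rintro (h | ⟨k, hk, rfl⟩) <;> omega
  rw [hs, Finset.prod_union, Finset.prod_map, Nat.add_sub_cancel_left]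
  · congr 1
    · rw [← Finset.prod_range_add_one_eq_factorial, Nat.cast_prod,
        ← Finset.prod_range_reflect (fun k => ((k + 1 : ℕ) : ℝ))]
      refine Finset.prod_congr rfl fun j hj => ?_
      have hj' := Finset.mem_range.1 hj
      have h1 : ((i - 1 - j + 1 : ℕ) : ℝ) = i - j := by
        rw [show i - 1 - j + 1 = i - j by omega, Nat.cast_sub hj'.le]
      rw [h1, abs_of_pos (sub_pos.2 (by exact_mod_cast hj'))]
    · rw [← Finset.prod_range_add_one_eq_factorial, Nat.cast_prod]
      refine Finset.prod_congr rfl fun j _ => ?_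
      simp only [Function.Embedding.coeFn_mk]
      rw [abs_sub_comm, abs_of_nonneg] <;> push_cast
      · ring
      · linarith [(Nat.cast_nonneg j : (0 : ℝ) ≤ j)]
  · rw [Finset.disjoint_left]
    intro j hj hj'
    simp only [Finset.mem_range, Finset.mem_map, Function.Embedding.coeFn_mk] at hj hj'
    obtain ⟨k, -, rfl⟩ := hj'
    omega

lemma sum_inv_factorial_mul_factorial (n : ℕ) :
    ∑ i ∈ Finset.range (n + 1), ((i.factorial : ℝ) * (n - i).factorial)⁻¹ =
      2 ^ n / n.factorial := by
  have h := Nat.sum_range_choose n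
  have h' : (∑ i ∈ Finset.range (n + 1), (n.choose i : ℝ)) = 2 ^ n := by exact_mod_cast h
  rw [← h', Finset.sum_div]
  refine Finset.sum_congr rfl fun i hi => ?_
  rw [Nat.cast_choose ℝ (Nat.lt_succ_iff.1 (Finset.mem_range.1 hi))]
  have := Nat.cast_ne_zero (R := ℝ).2 n.factorial_ne_zero
  field_simp

open Polynomial in
/-- A Remez-type inequality: a bound for a polynomial on an arc propagates to the circle. -/
lemma norm_eval_le_of_bound_on_arc {n : ℕ} (hn : 1 ≤ n) {δ : ℝ} (hδ : 0 < δ) (hδ1 : δ ≤ 1)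
    (q : ℂ[X]) (hq : q.natDegree ≤ n) (α c : ℝ)
    (hc : ∀ x ∈ Set.Icc α (α + δ / 2), ‖q.eval (unitExp x)‖ ≤ c) (z : ℂ) (hz : ‖z‖ = 1) :
    ‖q.eval z‖ ≤ c * (2 * Real.exp 1 / δ) ^ n := by
  have hn0 : (0 : ℝ) < n := by exact_mod_cast hn
  have hc0 : 0 ≤ c := (norm_nonneg _).trans (hc α ⟨le_rfl, by linarith⟩)
  set t : ℕ → ℝ := fun j => α + j * (δ / (2 * n)) with ht
  have hsub (i j : ℕ) : |t i - t j| = |(i : ℝ) - j| * (δ / (2 * n)) := by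
    rw [show t i - t j = ((i : ℝ) - j) * (δ / (2 * n)) by simp only [ht]; ring, abs_mul,
      abs_of_pos (show 0 < δ / (2 * n) by positivity)]
  have hsep {i j : ℕ} (hi : i ∈ Finset.range (n + 1)) (hj : j ∈ Finset.range (n + 1)) :
      |(i : ℝ) - j| * (2 * δ / n) ≤ ‖unitExp (t i) - unitExp (t j)‖ := by
    have hi' : (i : ℝ) ≤ n := by exact_mod_cast Nat.lt_succ_iff.1 (Finset.mem_range.1 hi)
    have hj' : (j : ℝ) ≤ n := by exact_mod_cast Nat.lt_succ_iff.1 (Finset.mem_range.1 hj)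
    have h1 : |(i : ℝ) - j| ≤ n := by
      rw [abs_le]
      constructor <;> linarith [(Nat.cast_nonneg i : (0 : ℝ) ≤ i), (Nat.cast_nonneg j : (0 : ℝ) ≤ j)]
    have h2 : |t i - t j| ≤ 1 / 2 := by
      rw [hsub]
      calc |(i : ℝ) - j| * (δ / (2 * n)) ≤ n * (δ / (2 * n)) := by gcongr
        _ = δ / 2 := by field_simp
        _ ≤ 1 / 2 := by linarith
    have h3 := four_mul_abs_sub_le_norm_unitExp_sub h2
    rw [hsub] at h3
    calc |(i : ℝ) - j| * (2 * δ / n) = 4 * (|(i : ℝ) - j| * (δ / (2 * n))) := by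
          field_simp; norm_num
      _ ≤ _ := h3
  have hpos {i j : ℕ} (hij : i ≠ j) : 0 < |(i : ℝ) - j| * (2 * δ / n) := by
    have : 0 < |(i : ℝ) - j| := abs_pos.2 (sub_ne_zero.2 (by exact_mod_cast hij))
    positivity
  have hinj : Set.InjOn (fun j => unitExp (t j)) (Finset.range (n + 1) : Finset ℕ) := by
    intro i hi j hj hij
    by_contra hne
    have := (hpos hne).trans_le (hsep hi hj)
    simp only at hij
    rw [hij, sub_self, norm_zero] at this
    exact lt_irrefl _ this
  have hdeg : q.degree < (Finset.range (n + 1)).card := by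
    rw [Finset.card_range]
    exact (natDegree_le_iff_degree_le.1 hq).trans_lt (by exact_mod_cast Nat.lt_succ_self n)
  have hbasis {i : ℕ} (hi : i ∈ Finset.range (n + 1)) :
      ‖(Lagrange.basis (Finset.range (n + 1)) (fun j => unitExp (t j)) i).eval z‖ ≤
        (n / δ) ^ n * ((i.factorial : ℝ) * (n - i).factorial)⁻¹ := by
    rw [Lagrange.basis, eval_prod, norm_prod]
    calc ∏ j ∈ (Finset.range (n + 1)).erase i,
          ‖(Lagrange.basisDivisor (unitExp (t i)) (unitExp (t j))).eval z‖
        ≤ ∏ j ∈ (Finset.range (n + 1)).erase i, (n / δ) * |(i : ℝ) - j|⁻¹ := by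
          refine Finset.prod_le_prod (fun _ _ => norm_nonneg _) fun j hj => ?_
          obtain ⟨hji, hj⟩ := Finset.mem_erase.1 hj
          have h1 := hsep hi hj
          have h2 := hpos hji.symm
          have h3 : ‖z - unitExp (t j)‖ ≤ 2 := by
            refine (norm_sub_le _ _).trans ?_
            rw [hz, norm_unitExp]
            norm_num
          have h4 : |(i : ℝ) - j| ≠ 0 := fun h => by simp [h] at h2
          simp only [Lagrange.basisDivisor, eval_mul, eval_C, eval_sub, eval_X, norm_mul, norm_inv]
          calc ‖unitExp (t i) - unitExp (t j)‖⁻¹ * ‖z - unitExp (t j)‖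
              ≤ (|(i : ℝ) - j| * (2 * δ / n))⁻¹ * 2 := by gcongr
            _ = (n / δ) * |(i : ℝ) - j|⁻¹ := by field_simp
      _ = _ := by
          rw [Finset.prod_mul_distrib, Finset.prod_const, Finset.prod_inv_distrib,
            Finset.card_erase_of_mem hi, Finset.card_range, Nat.add_sub_cancel,
            prod_erase_range_abs_sub (Nat.lt_succ_iff.1 (Finset.mem_range.1 hi))]
  have hmem {i : ℕ} (hi : i ∈ Finset.range (n + 1)) : t i ∈ Set.Icc α (α + δ / 2) := by
    have hi' : (i : ℝ) ≤ n := by exact_mod_cast Nat.lt_succ_iff.1 (Finset.mem_range.1 hi)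
    refine ⟨le_add_of_nonneg_right (by positivity), add_le_add le_rfl ?_⟩
    calc (i : ℝ) * (δ / (2 * n)) ≤ n * (δ / (2 * n)) := by gcongr
      _ = δ / 2 := by field_simp
  rw [Lagrange.eq_interpolate hinj hdeg, Lagrange.interpolate_apply, eval_finsetSum]
  calc ‖∑ i ∈ Finset.range (n + 1), (C (q.eval (unitExp (t i))) *
        Lagrange.basis (Finset.range (n + 1)) (fun j => unitExp (t j)) i).eval z‖
      ≤ ∑ i ∈ Finset.range (n + 1),
          c * ((n / δ) ^ n * ((i.factorial : ℝ) * (n - i).factorial)⁻¹) := by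
        refine norm_sum_le_of_le _ fun i hi => ?_
        rw [eval_mul, eval_C, norm_mul]
        exact mul_le_mul (hc _ (hmem hi)) (hbasis hi) (norm_nonneg _) hc0
    _ = c * ((2 / δ) ^ n * (n ^ n / n.factorial)) := by
        rw [← Finset.mul_sum, ← Finset.mul_sum, sum_inv_factorial_mul_factorial, div_pow, div_pow]
        ring
    _ ≤ c * ((2 / δ) ^ n * Real.exp n) := by
        gcongr
        exact Real.pow_div_factorial_le_exp _ hn0.le n
    _ = c * (2 * Real.exp 1 / δ) ^ n := by
        rw [← Real.exp_one_pow, ← mul_pow, mul_div_right_comm]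

open Polynomial in
/-- A level set of `|q|` on the unit circle, other than the whole circle, has at most `2 * n`
points. -/
lemma card_le_of_norm_eval_eq {n : ℕ} (q : ℂ[X]) (hq : q.natDegree ≤ n) (a c u : ℝ)
    (hc : 0 ≤ c) (hu : ‖q.eval (unitExp u)‖ ≠ c) (Y : Finset ℝ)
    (hYa : ∀ y ∈ Y, y ∈ Set.Ioo a (a + 1)) (hY : ∀ y ∈ Y, ‖q.eval (unitExp y)‖ = c) :
    Y.card ≤ 2 * n := by
  set P : ℂ[X] := q * (q.map (starRingEnd ℂ)).reflect n - C ((c : ℂ) ^ 2) * X ^ n with hP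
  have hPeval (x : ℝ) : P.eval (unitExp x) =
      (((‖q.eval (unitExp x)‖ ^ 2 - c ^ 2 : ℝ)) : ℂ) * unitExp x ^ n := by
    set z := unitExp x with hz
    have hzz : z * (starRingEnd ℂ) z = 1 := by
      rw [mul_conj, normSq_eq_norm_sq, hz, norm_unitExp]
      norm_num
    have hrefl : ((q.map (starRingEnd ℂ)).reflect n).eval z =
        (starRingEnd ℂ) (q.eval z) * z ^ n := by
      let : Invertible ((starRingEnd ℂ) z) := ⟨z, hzz, by rw [mul_comm]; exact hzz⟩
      have h := eval₂_reflect_mul_pow (RingHom.id ℂ) ((starRingEnd ℂ) z) n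
        (q.map (starRingEnd ℂ)) (by rwa [natDegree_map])
      have hinv : ⅟((starRingEnd ℂ) z) = z := rfl
      have hev : eval ((starRingEnd ℂ) z) (q.map (starRingEnd ℂ)) = (starRingEnd ℂ) (q.eval z) := by
        rw [eval_map, eval₂_at_apply]
      rw [hinv, eval₂_id, eval₂_id, hev] at h
      rw [← h, mul_assoc, ← mul_pow, mul_comm ((starRingEnd ℂ) z), hzz, one_pow, mul_one]
    rw [hP, eval_sub, eval_mul, eval_mul, eval_C, eval_pow, eval_X, hrefl, ← mul_assoc, mul_conj,
      normSq_eq_norm_sq]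
    push_cast
    ring
  have hP0 : P ≠ 0 := by
    intro h
    have h1 := hPeval u
    rw [h, eval_zero, eq_comm, mul_eq_zero] at h1
    rcases h1 with h1 | h1
    · have h2 : ‖q.eval (unitExp u)‖ ^ 2 = c ^ 2 := sub_eq_zero.1 (by exact_mod_cast h1)
      exact hu ((pow_left_inj₀ (norm_nonneg _) hc two_ne_zero).1 h2)
    · exact pow_ne_zero n (unitExp_ne_zero u) h1
  have hPdeg : P.natDegree ≤ 2 * n := by
    refine (natDegree_sub_le _ _).trans (max_le (natDegree_mul_le.trans ?_)
      ((natDegree_C_mul_X_pow_le _ _).trans (by omega)))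
    have h := natDegree_reflect_le (p := q.map (starRingEnd ℂ)) (N := n)
    rw [natDegree_map, max_eq_left hq] at h
    omega
  rw [← Finset.card_image_of_injOn (s := Y) (f := unitExp)
    fun x hx y hy h => unitExp_injOn a (hYa x hx) (hYa y hy) h]
  refine (card_le_degree_of_subset_roots fun z hz => ?_).trans hPdeg
  obtain ⟨y, hy, rfl⟩ := Finset.mem_image.1 hz
  rw [mem_roots hP0, IsRoot, hPeval, hY y hy]
  simp

/-- The pairs of endpoints of the components of `{F < c}` in the interval `[a, b]`. -/
def sublevelComponents (F : ℝ → ℝ) (a b c : ℝ) : Set (ℝ × ℝ) :=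
  {p | a ≤ p.1 ∧ p.1 < p.2 ∧ p.2 ≤ b ∧ c ≤ F p.1 ∧ c ≤ F p.2 ∧ ∀ x ∈ Set.Ioo p.1 p.2, F x < c}

lemma exists_mem_sublevelComponents {F : ℝ → ℝ} (hF : Continuous F) {a b c x : ℝ}
    (ha : c ≤ F a) (hb : c ≤ F b) (hx : x ∈ Set.Icc a b) (hxc : F x < c) :
    ∃ p ∈ sublevelComponents F a b c, x ∈ Set.Ioo p.1 p.2 := by
  have hcl : IsClosed {y | c ≤ F y} := isClosed_le continuous_const hF
  obtain ⟨l, hl, hlub⟩ := (isCompact_Icc.inter_right hcl : IsCompact (Set.Icc a x ∩ _))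
    |>.exists_isGreatest ⟨a, ⟨le_rfl, hx.1⟩, ha⟩
  obtain ⟨r, hr, hrlb⟩ := (isCompact_Icc.inter_right hcl : IsCompact (Set.Icc x b ∩ _))
    |>.exists_isLeast ⟨b, ⟨hx.2, le_rfl⟩, hb⟩
  have hl2 : c ≤ F l := hl.2
  have hr2 : c ≤ F r := hr.2
  have hlx : l < x := lt_of_le_of_ne hl.1.2 (by rintro rfl; linarith)
  have hxr : x < r := lt_of_le_of_ne hr.1.1 (by rintro rfl; linarith)
  refine ⟨(l, r), ⟨hl.1.1, hlx.trans hxr, hr.1.2, hl2, hr2, fun y hy => ?_⟩, hlx, hxr⟩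
  by_contra! hyc
  rcases le_total y x with h | h
  · exact absurd (hlub ⟨⟨hl.1.1.trans hy.1.le, h⟩, hyc⟩) (not_le.2 hy.1)
  · exact absurd (hrlb ⟨⟨h, hy.2.le.trans hr.1.2⟩, hyc⟩) (not_le.2 hy.2)

lemma sublevelComponents_eq_of_mem {F : ℝ → ℝ} {a b c x : ℝ} {p p' : ℝ × ℝ}
    (hp : p ∈ sublevelComponents F a b c) (hp' : p' ∈ sublevelComponents F a b c)
    (hx : x ∈ Set.Ioo p.1 p.2) (hx' : x ∈ Set.Ioo p'.1 p'.2) : p = p' := by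
  obtain ⟨-, -, -, h1, h2, h3⟩ := hp
  obtain ⟨-, -, -, h1', h2', h3'⟩ := hp'
  refine Prod.ext (le_antisymm ?_ ?_) (le_antisymm ?_ ?_) <;> by_contra! h
  · exact absurd (h3' _ ⟨h, hx.1.trans hx'.2⟩) (not_lt.2 h1)
  · exact absurd (h3 _ ⟨h, hx'.1.trans hx.2⟩) (not_lt.2 h1')
  · exact absurd (h3 _ ⟨hx.1.trans hx'.2, h⟩) (not_lt.2 h2')
  · exact absurd (h3' _ ⟨hx'.1.trans hx.2, h⟩) (not_lt.2 h2)

/-- If every level set slightly below `c` has at most `2 * n` points, then `{F < c}` has at most `n`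
components. -/
lemma card_le_of_subset_sublevelComponents {F : ℝ → ℝ} (hF : Continuous F) {a b c : ℝ} {n : ℕ}
    (hlevel : ∀ c' u, F u < c' → ∀ Y : Finset ℝ, (∀ y ∈ Y, y ∈ Set.Ioo a b) →
      (∀ y ∈ Y, F y = c') → Y.card ≤ 2 * n)
    (t : Finset (ℝ × ℝ)) (ht : ∀ p ∈ t, p ∈ sublevelComponents F a b c) : t.card ≤ n := by
  classical
  rcases t.eq_empty_or_nonempty with rfl | ⟨p₀, hp₀⟩
  · simp
  set u : ℝ × ℝ → ℝ := fun p => (p.1 + p.2) / 2 with hu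
  have humem {p} (hp : p ∈ t) : u p ∈ Set.Ioo p.1 p.2 := by
    have := (ht p hp).2.1
    constructor <;> simp only [hu] <;> linarith
  obtain ⟨c', hc', hc'c⟩ : ∃ c', (∀ p ∈ t, F (u p) < c') ∧ c' < c := by
    have h1 : ∀ᶠ y in nhdsWithin c (Set.Iio c), ∀ p ∈ t, F (u p) < y :=
      (Filter.eventually_all_finset t).2 fun p hp =>
        (eventually_gt_nhds ((ht p hp).2.2.2.2.2 _ (humem hp))).filter_mono nhdsWithin_le_nhds
    exact (h1.and self_mem_nhdsWithin).exists
  have hleft : ∀ p ∈ t, ∃ w ∈ Set.Ioo p.1 (u p), F w = c' := fun p hp =>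
    intermediate_value_Ioo' (humem hp).1.le hF.continuousOn
      ⟨hc' p hp, hc'c.trans_le (ht p hp).2.2.2.1⟩
  have hright : ∀ p ∈ t, ∃ w ∈ Set.Ioo (u p) p.2, F w = c' := fun p hp =>
    intermediate_value_Ioo (humem hp).2.le hF.continuousOn
      ⟨hc' p hp, hc'c.trans_le (ht p hp).2.2.2.2.1⟩
  choose! v hv hvF using hleft
  choose! w hw hwF using hright
  have hvI {p} (hp : p ∈ t) : v p ∈ Set.Ioo p.1 p.2 :=
    ⟨(hv p hp).1, (hv p hp).2.trans (humem hp).2⟩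
  have hwI {p} (hp : p ∈ t) : w p ∈ Set.Ioo p.1 p.2 :=
    ⟨(humem hp).1.trans (hw p hp).1, (hw p hp).2⟩
  have hvinj : Set.InjOn v t := fun p hp p' hp' h =>
    sublevelComponents_eq_of_mem (ht p hp) (ht p' hp') (hvI hp) (h ▸ hvI hp')
  have hwinj : Set.InjOn w t := fun p hp p' hp' h =>
    sublevelComponents_eq_of_mem (ht p hp) (ht p' hp') (hwI hp) (h ▸ hwI hp')
  have hdisj : Disjoint (t.image v) (t.image w) := by
    rw [Finset.disjoint_left]
    intro x hx hx'
    obtain ⟨p, hp, rfl⟩ := Finset.mem_image.1 hx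
    obtain ⟨p', hp', h⟩ := Finset.mem_image.1 hx'
    obtain rfl := sublevelComponents_eq_of_mem (ht p hp) (ht p' hp') (hvI hp) (h ▸ hwI hp')
    linarith [(hv p hp).2, (hw p hp).1]
  have hsub {p x} (hp : p ∈ t) (hx : x ∈ Set.Ioo p.1 p.2) : x ∈ Set.Ioo a b :=
    ⟨(ht p hp).1.trans_lt hx.1, hx.2.trans_le (ht p hp).2.2.1⟩
  have key := hlevel c' (u p₀) (hc' p₀ hp₀) (t.image v ∪ t.image w) ?_ ?_
  · rw [Finset.card_union_of_disjoint hdisj, Finset.card_image_of_injOn hvinj,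
      Finset.card_image_of_injOn hwinj] at key
    omega
  · simp only [Finset.mem_union, Finset.mem_image]
    rintro y (⟨p, hp, rfl⟩ | ⟨p, hp, rfl⟩)
    · exact hsub hp (hvI hp)
    · exact hsub hp (hwI hp)
  · simp only [Finset.mem_union, Finset.mem_image]
    rintro y (⟨p, hp, rfl⟩ | ⟨p, hp, rfl⟩)
    · exact hvF p hp
    · exact hwF p hp

lemma exists_fin_iUnion_Ioo_eq {I : Set (ℝ × ℝ)} {n : ℕ} {Δ : ℝ} (hΔ : 0 ≤ Δ)
    (hI : ∀ p ∈ I, p.1 < p.2 ∧ p.2 - p.1 ≤ Δ)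
    (hcard : ∀ t : Finset (ℝ × ℝ), (∀ p ∈ t, p ∈ I) → t.card ≤ n) :
    ∃ cen len : Fin n → ℝ, (∀ j, 0 ≤ len j ∧ len j ≤ Δ) ∧
      ⋃ j, Set.Ioo (cen j) (cen j + len j) = ⋃ p ∈ I, Set.Ioo p.1 p.2 := by
  have hfin : I.Finite := by
    by_contra h
    obtain ⟨t, ht, htc⟩ := Set.Infinite.exists_subset_card_eq h (n + 1)
    have := hcard t fun p hp => ht hp
    omega
  have hle : Fintype.card hfin.toFinset ≤ Fintype.card (Fin n) := by
    rw [Fintype.card_coe, Fintype.card_fin]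
    exact hcard _ fun p hp => hfin.mem_toFinset.1 hp
  obtain ⟨f⟩ := Function.Embedding.nonempty_of_card_le hle
  set g : Fin n → ℝ × ℝ := Function.extend f Subtype.val fun _ => (0, 0) with hg
  have hgI (j : Fin n) : g j ∈ I ∨ g j = (0, 0) := by
    by_cases hj : ∃ i, f i = j
    · obtain ⟨i, rfl⟩ := hj
      left
      rw [hg, f.injective.extend_apply]
      exact hfin.mem_toFinset.1 i.2
    · exact Or.inr (Function.extend_apply' _ _ _ hj)
  refine ⟨fun j => (g j).1, fun j => (g j).2 - (g j).1, fun j => ?_, ?_⟩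
  · rcases hgI j with h | h
    · exact ⟨sub_nonneg.2 (hI _ h).1.le, (hI _ h).2⟩
    · simp [h, hΔ]
  · ext x
    simp only [add_sub_cancel, Set.mem_iUnion, exists_prop]
    constructor
    · rintro ⟨j, hj⟩
      rcases hgI j with h | h
      · exact ⟨_, h, hj⟩
      · simp only [h, Set.Ioo_self, Set.mem_empty_iff_false] at hj
    · rintro ⟨p, hp, hx⟩
      refine ⟨f ⟨p, hfin.mem_toFinset.2 hp⟩, ?_⟩
      rw [hg, f.injective.extend_apply]
      exact hx

open Polynomial in
lemma length_le_of_norm_eval_lt {n : ℕ} (hn : 1 ≤ n) {Δ : ℝ} (hΔ : 0 < Δ) (hΔ1 : Δ ≤ 1)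
    (q : ℂ[X]) (hq : q.natDegree ≤ n) (hq2 : ∑ i ∈ q.support, ‖q.coeff i‖ ^ 2 = 1) {α β : ℝ}
    (h : ∀ x ∈ Set.Ioo α β, ‖q.eval (unitExp x)‖ < (Δ / (4 * Real.exp 1)) ^ n) :
    β - α ≤ Δ := by
  by_contra! hlt
  have h1 := sum_sq_norm_coeff_le_of_norm_eval_le q _ <|
    norm_eval_le_of_bound_on_arc hn hΔ hΔ1 q hq (α + (β - α) / 4) _ fun x hx =>
      (h x ⟨by linarith [hx.1], by linarith [hx.2]⟩).le
  have h2 : Δ / (4 * Real.exp 1) * (2 * Real.exp 1 / Δ) = 1 / 2 := by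
    have := Real.exp_pos 1
    field_simp
    norm_num
  rw [hq2, ← mul_pow, h2, ← pow_mul] at h1
  have h3 : (1 / 2 : ℝ) ^ (n * 2) < 1 := pow_lt_one₀ (by norm_num) (by norm_num) (by omega)
  linarith

/-- **Sublevel sets of trigonometric polynomials are unions of at most `n` short arcs.**
There is a constant `A ≥ 1` such that for every `n ≥ 1`, every `Δ ∈ (0,1)` and every
polynomial `q(z) = ∑_{k=0}^n a_k z^k` with `∑ |a_k|² = 1`, the set
`U = {s ∈ ℝ/ℤ : |q(e(s))| < (Δ/A)^n}` is a union of at most `n` open arcs, each of length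
at most `Δ`. -/
theorem sublevel_set_union_of_arcs :
    ∃ A : ℝ, 1 ≤ A ∧
      ∀ n : ℕ, 1 ≤ n →
        ∀ Δ : ℝ, 0 < Δ → Δ < 1 →
          ∀ a : Fin (n + 1) → ℂ, (∑ k, ‖a k‖ ^ 2) = 1 →
            ∃ cen len : Fin n → ℝ,
              (∀ j, 0 ≤ len j ∧ len j ≤ Δ) ∧
              {s : AddCircle (1 : ℝ) |
                  ‖∑ k : Fin (n + 1), a k * fourier ((k : ℕ) : ℤ) s‖ < (Δ / A) ^ n} =
                ⋃ j : Fin n,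
                  (fun x : ℝ => (x : AddCircle (1 : ℝ))) '' Set.Ioo (cen j) (cen j + len j) := by
  refine ⟨4 * Real.exp 1, by linarith [Real.add_one_le_exp 1], fun n hn Δ hΔ hΔ1 a ha => ?_⟩
  set q : Polynomial ℂ := ∑ k : Fin (n + 1), Polynomial.monomial (k : ℕ) (a k) with hqdef
  have hcoeff (k : Fin (n + 1)) : q.coeff k = a k := by
    simp [hqdef, Polynomial.coeff_monomial, Fin.val_inj]
  have hdeg : q.natDegree ≤ n :=
    Polynomial.natDegree_sum_le_of_forall_le _ _ fun k _ =>
      (Polynomial.natDegree_monomial_le _).trans (Nat.lt_succ_iff.1 k.2)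
  have hsum : ∑ i ∈ q.support, ‖q.coeff i‖ ^ 2 = 1 := by
    rw [← ha, Finset.sum_subset (s₂ := Finset.range (n + 1))
      (fun i hi => Finset.mem_range.2
        (Nat.lt_succ_iff.2 ((Polynomial.le_natDegree_of_mem_supp i hi).trans hdeg)))
      (fun i _ hi => by simp [Polynomial.notMem_support_iff.1 hi]), Finset.sum_range]
    simp_rw [hcoeff]
  set c : ℝ := (Δ / (4 * Real.exp 1)) ^ n with hc
  set F : ℝ → ℝ := fun x => ‖q.eval (unitExp x)‖ with hFdef
  have hF : Continuous F := by fun_prop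
  have hfourier (x : ℝ) :
      ‖∑ k : Fin (n + 1), a k * fourier ((k : ℕ) : ℤ) (x : AddCircle (1 : ℝ))‖ = F x := by
    simp only [hFdef, hqdef, Polynomial.eval_finsetSum, Polynomial.eval_monomial]
    congr 1
    refine Finset.sum_congr rfl fun k _ => ?_
    rw [fourier_coe_apply, unitExp, ← exp_nat_mul]
    congr 2
    push_cast
    ring
  have hlen {α β : ℝ} (h : ∀ x ∈ Set.Ioo α β, F x < c) : β - α ≤ Δ :=
    length_le_of_norm_eval_lt hn hΔ hΔ1.le q hdeg hsum h
  obtain ⟨x₀, hx₀⟩ : ∃ x₀, c ≤ F x₀ := by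
    by_contra! h
    linarith [hlen (α := 0) (β := 2) fun x _ => h x]
  have hper (x : ℝ) (m : ℤ) : F (x + m) = F x := by simp only [hFdef, unitExp_add_int]
  have hx₁ : c ≤ F (x₀ + 1) := by simpa using hx₀.trans_eq (hper x₀ 1).symm
  obtain ⟨cen, len, hbd, hU⟩ := exists_fin_iUnion_Ioo_eq (I := sublevelComponents F x₀ (x₀ + 1) c)
    hΔ.le (fun p hp => ⟨hp.2.1, hlen hp.2.2.2.2.2⟩)
    (card_le_of_subset_sublevelComponents hF fun c' u hu Y hYa hY =>
      card_le_of_norm_eval_eq q hdeg x₀ c' u ((norm_nonneg _).trans hu.le) hu.ne Y hYa hY)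
  refine ⟨cen, len, hbd, ?_⟩
  rw [← Set.image_iUnion, hU]
  ext s
  simp only [Set.mem_ofPred_eq, Set.mem_image, Set.mem_iUnion, exists_prop]
  constructor
  · intro hs
    obtain ⟨x, hx, rfl⟩ : ∃ x ∈ Set.Ico x₀ (x₀ + 1), (x : AddCircle (1 : ℝ)) = s :=
      ⟨_, (AddCircle.equivIco 1 x₀ s).2, AddCircle.coe_equivIco⟩
    rw [hfourier] at hs
    exact ⟨x, exists_mem_sublevelComponents hF hx₀ hx₁ (Set.Ico_subset_Icc_self hx) hs, rfl⟩
  · rintro ⟨x, ⟨p, hp, hx⟩, rfl⟩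
    rw [hfourier]
    exact hp.2.2.2.2.2 x hx
end

section
/- Let n ≥ 1, let z_1,…,z_n be nonzero complex numbers, let g(z) = c·∏_{j=1}^n (z − z_j) be a polynomial of degree n (c ≠ 0) with sup_{|z|=1} |g(z)| ≥ 1, and let h(z) = ∏_{j=1}^n (z − ζ_j) where ζ_j = z_j/|z_j|. Then |h(z)| ≤ 2^n |g(z)| for every z with |z| = 1. -/
open Complex

/-- Inversion in the unit circle: `|rz - w| = |z - rw|` for unimodular `z`, `w` and real `r`. -/
theorem norm_ofReal_mul_sub_eq_norm_sub_ofReal_mul {z w : ℂ} (hz : ‖z‖ = 1) (hw : ‖w‖ = 1)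
    (r : ℝ) : ‖(r : ℂ) * z - w‖ = ‖z - r * w‖ := by
  have hz' : z.re * z.re + z.im * z.im = 1 := by
    rw [← normSq_apply, ← Complex.sq_norm, hz, one_pow]
  have hw' : w.re * w.re + w.im * w.im = 1 := by
    rw [← normSq_apply, ← Complex.sq_norm, hw, one_pow]
  rw [← sq_eq_sq₀ (norm_nonneg _) (norm_nonneg _), Complex.sq_norm, Complex.sq_norm,
    normSq_apply, normSq_apply]
  simp only [sub_re, sub_im, re_ofReal_mul, im_ofReal_mul]
  linear_combination (r ^ 2 - 1) * hz' - (r ^ 2 - 1) * hw'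

/-- Each linear factor changes by a factor at most `2 / (1 + |a|)` under radial projection. -/
theorem norm_sub_div_norm_mul_one_add_norm_le {z a : ℂ} (hz : ‖z‖ = 1) (ha : a ≠ 0) :
    ‖z - a / (‖a‖ : ℂ)‖ * (1 + ‖a‖) ≤ 2 * ‖z - a‖ := by
  have ha' : (‖a‖ : ℂ) ≠ 0 := by simpa using ha
  have hw : ‖a / (‖a‖ : ℂ)‖ = 1 := by simp [ha]
  have key := norm_ofReal_mul_sub_eq_norm_sub_ofReal_mul hz hw ‖a‖
  rw [mul_div_cancel₀ a ha'] at key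
  have hsplit : (z - a / (‖a‖ : ℂ)) * ((1 + ‖a‖ : ℝ) : ℂ) =
      (z - a) + ((‖a‖ : ℂ) * z - a / (‖a‖ : ℂ)) := by
    push_cast
    field_simp
    ring
  calc ‖z - a / (‖a‖ : ℂ)‖ * (1 + ‖a‖)
      = ‖(z - a / (‖a‖ : ℂ)) * ((1 + ‖a‖ : ℝ) : ℂ)‖ := by
        rw [norm_mul, norm_real, Real.norm_of_nonneg (by positivity)]
    _ ≤ ‖z - a‖ + ‖(‖a‖ : ℂ) * z - a / (‖a‖ : ℂ)‖ := hsplit ▸ norm_add_le _ _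
    _ = 2 * ‖z - a‖ := by rw [key, two_mul]

/-- **Radial projection of roots to the unit circle.**
Let `g(z) = c ∏_{j=1}^n (z − z_j)` with `z_j ≠ 0` and `sup_{|z|=1} |g| ≥ 1`, and let
`h(z) = ∏_{j=1}^n (z − ζ_j)` where `ζ_j = z_j/|z_j|`.  Then `|h(z)| ≤ 2ⁿ |g(z)|` on the
unit circle. -/
theorem radial_projection_of_roots :
    ∀ n : ℕ, 1 ≤ n →
      ∀ zs : Fin n → ℂ, (∀ j, zs j ≠ 0) →
        ∀ c : ℂ, c ≠ 0 →
          (1 ≤ ⨆ z : Metric.sphere (0 : ℂ) 1, ‖c * ∏ j, ((z : ℂ) - zs j)‖) →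
          ∀ z : ℂ, ‖z‖ = 1 →
            ‖∏ j, (z - zs j / (‖zs j‖ : ℂ))‖ ≤ 2 ^ n * ‖c * ∏ j, (z - zs j)‖ := by
  intro n _ zs hzs c _ hsup z hz
  have : Nonempty (Metric.sphere (0 : ℂ) 1) := ⟨⟨1, by simp⟩⟩
  have hbound : 1 ≤ ‖c‖ * ∏ j, (1 + ‖zs j‖) := by
    refine hsup.trans (ciSup_le fun w => ?_)
    rw [norm_mul, norm_prod]
    gcongr with j
    simpa using norm_sub_le (w : ℂ) (zs j)
  rw [norm_mul, norm_prod, norm_prod]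
  calc ∏ j, ‖z - zs j / (‖zs j‖ : ℂ)‖
      ≤ (∏ j, ‖z - zs j / (‖zs j‖ : ℂ)‖) * (‖c‖ * ∏ j, (1 + ‖zs j‖)) :=
        le_mul_of_one_le_right (by positivity) hbound
    _ = ‖c‖ * ∏ j, ‖z - zs j / (‖zs j‖ : ℂ)‖ * (1 + ‖zs j‖) := by
        rw [Finset.prod_mul_distrib]
        ring
    _ ≤ ‖c‖ * ∏ j, 2 * ‖z - zs j‖ := by
        refine mul_le_mul_of_nonneg_left (Finset.prod_le_prod (fun j _ => by positivity)
          fun j _ => ?_) (norm_nonneg c)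
        exact norm_sub_div_norm_mul_one_add_norm_le hz (hzs j)
    _ = 2 ^ n * (‖c‖ * ∏ j, ‖z - zs j‖) := by
        rw [Finset.prod_mul_distrib, Finset.prod_const, Finset.card_univ, Fintype.card_fin]
        ring
end
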